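/- Let G be a finite group such that φ(S) ≠ 0 for every subgroup S of G, and such that for all subgroups H, K of G with H ⊆ K, φ(H) divides φ(K). Then G is nilpotent and each Sylow subgroup of G is cyclic, isomorphic to the quaternion group Q₈, or isomorphic to ℤ_p × ℤ_p for some prime p. -/

import Mathlib

/-- For a finite group `G`, `phi G` is the number of elements of `G` whose order
equals the exponent of `G`. -/
noncomputable def phi (G : Type*) [Group G] : ℕ :=
  Nat.card {a : G // orderOf a = Monoid.exponent G}

open Subgroup

/-- Every subgroup has an element of order its exponent, and `phi` is monotone with respect to
divisibility on subgroups. -/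
structure PhiDivisible (G : Type*) [Group G] : Prop where
  phi_ne_zero : ∀ S : Subgroup G, phi S ≠ 0
  phi_dvd_phi : ∀ H K : Subgroup G, H ≤ K → phi H ∣ phi K

theorem phi_congr {G H : Type*} [Group G] [Group H] (e : G ≃* H) : phi G = phi H := by
  unfold phi
  rw [Monoid.exponent_eq_of_mulEquiv e]
  refine Nat.card_congr (e.toEquiv.subtypeEquiv fun a => ?_)
  change _ ↔ orderOf (e a) = _
  rw [e.orderOf_eq]

theorem phi_of_isCyclic (C : Type*) [Group C] [Finite C] [IsCyclic C] :
    phi C = Nat.totient (Nat.card C) := by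
  have := Fintype.ofFinite C
  classical
  unfold phi
  rw [IsCyclic.exponent_eq_card, Nat.card_eq_fintype_card, Fintype.card_subtype,
    Nat.card_eq_fintype_card]
  exact IsCyclic.card_orderOf_eq_totient dvd_rfl

namespace PhiDivisible

variable {G : Type*} [Group G] (h : PhiDivisible G)
include h

theorem subgroup (S : Subgroup G) : PhiDivisible S := by
  have key (T : Subgroup S) : phi T = phi (T.map S.subtype) :=
    phi_congr (T.equivMapOfInjective _ S.subtype_injective)
  refine ⟨fun T => ?_, fun H K hHK => ?_⟩
  · rw [key]
    exact h.phi_ne_zero _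
  · rw [key, key]
    exact h.phi_dvd_phi _ _ (map_mono hHK)

theorem phi_dvd (S : Subgroup G) : phi S ∣ phi G :=
  phi_congr (topEquiv (G := G)) ▸ h.phi_dvd_phi S ⊤ le_top

theorem phi_pos : 0 < phi G :=
  Nat.pos_of_ne_zero (phi_congr (topEquiv (G := G)) ▸ h.phi_ne_zero ⊤)

theorem exists_orderOf_eq_exponent : ∃ g : G, orderOf g = Monoid.exponent G := by
  obtain ⟨⟨g, hg⟩⟩ := (Nat.card_pos_iff.1 h.phi_pos).1
  exact ⟨g, hg⟩

theorem totient_orderOf_dvd [Finite G] (g : G) : Nat.totient (orderOf g) ∣ phi G := by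
  rw [← Nat.card_zpowers, ← phi_of_isCyclic]
  exact h.phi_dvd _

end PhiDivisible

theorem phi_of_exponent_eq_prime {G : Type*} [Group G] [Finite G] {p : ℕ} (hp : p.Prime)
    (hG : Monoid.exponent G = p) : phi G = Nat.card G - 1 := by
  have := Fintype.ofFinite G
  classical
  have : Nontrivial G := by
    rw [← not_subsingleton_iff_nontrivial]
    exact fun _ => hp.one_lt.ne (hG ▸ Monoid.exp_eq_one_iff.2 inferInstance).symm
  have hone := (Monoid.exponent_eq_prime_iff hp (G := G)).1 hG
  have hset : ∀ a : G, orderOf a = Monoid.exponent G ↔ a ≠ 1 := fun a => by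
    rw [hG]
    refine ⟨?_, hone a⟩
    rintro h rfl
    exact hp.one_lt.ne (by simpa using h)
  unfold phi
  rw [Nat.card_congr (Equiv.subtypeEquivRight hset), Nat.card_eq_fintype_card,
    Nat.card_eq_fintype_card, Fintype.card_subtype_compl, Fintype.card_subtype_eq]

theorem phi_add_card_le {G : Type*} [Group G] [Finite G] (E : Subgroup G)
    (hE : ∀ a ∈ E, orderOf a ≠ Monoid.exponent G) : phi G + Nat.card E ≤ Nat.card G := by
  classical
  have h1 : phi G ≤ Nat.card {a : G // ¬ a ∈ E} :=
    Nat.card_le_card_of_injective (fun a => ⟨a.1, fun ha => hE _ ha a.2⟩)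
      fun a b hab => Subtype.ext (by simpa using hab)
  have h2 : Nat.card E + Nat.card {a : G // ¬ a ∈ E} = Nat.card G := by
    rw [← Nat.card_sum]
    exact Nat.card_congr (Equiv.sumCompl (· ∈ E))
  omega

theorem PhiDivisible.isCyclic_of_card_eq_prime_sq_of_card_eq_prime_cube {G : Type*} [Group G]
    (h : PhiDivisible G) {p : ℕ} [hp : Fact p.Prime] (hG : Nat.card G = p ^ 3) {E : Subgroup G}
    (hE : Nat.card E = p ^ 2) : IsCyclic E := by
  by_contra hcyc
  have : Finite G := Nat.finite_of_card_ne_zero (hG ▸ pow_ne_zero 3 hp.out.ne_zero)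
  have hexpE := (not_isCyclic_iff_exponent_eq_prime hp.out hE).1 hcyc
  have hphiE := phi_of_exponent_eq_prime hp.out hexpE
  have hdvd := h.phi_dvd E
  rw [hphiE, hE] at hdvd
  have hp2 := hp.out.two_le
  obtain ⟨q, rfl⟩ : ∃ q, p = q + 1 := ⟨p - 1, by omega⟩
  obtain ⟨g, hg⟩ := h.exists_orderOf_eq_exponent
  obtain ⟨k, hk3, hk⟩ := (Nat.dvd_prime_pow hp.out).1 (hG ▸ orderOf_dvd_natCard g)
  have hpexp : q + 1 ∣ Monoid.exponent G :=
    hexpE ▸ Monoid.exponent_dvd_of_monoidHom E.subtype E.subtype_injective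
  have hsq : (q + 1) ^ 2 - 1 = q * (q + 2) := by
    rw [Nat.sub_eq_iff_eq_add (Nat.one_le_pow _ _ (by omega))]; ring
  rw [hsq] at hdvd
  interval_cases k
  · rw [← hg, hk] at hpexp
    simp at hpexp
    omega
  · have := phi_of_exponent_eq_prime hp.out (G := G) (by rw [← hg, hk, pow_one])
    rw [this, hG] at hdvd
    have e : (q + 1) ^ 3 - 1 = (q + 1) * (q * (q + 2)) + q := by
      rw [Nat.sub_eq_iff_eq_add (Nat.one_le_pow _ _ (by omega))]; ring
    rw [e, Nat.dvd_add_right (Dvd.intro_left _ rfl)] at hdvd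
    have := Nat.le_of_dvd (by omega) hdvd
    nlinarith
  · have htot := h.totient_orderOf_dvd g
    rw [hk, Nat.totient_prime_pow hp.out two_pos] at htot
    have hpd : q + 1 ∣ phi G := (dvd_mul_right (q + 1) q).trans (by simpa using htot)
    have hcop : Nat.Coprime (q + 1) (q * (q + 2)) := by
      rw [Nat.coprime_mul_iff_right]
      refine ⟨by simp, ?_⟩
      rw [show q + 2 = q + 1 + 1 from rfl]
      exact Nat.coprime_self_add_right.2 (by simp)
    have hle := Nat.le_of_dvd h.phi_pos (hcop.mul_dvd_of_dvd_of_dvd hpd hdvd)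
    have hle2 := phi_add_card_le E fun a ha hor => by
      have : orderOf (⟨a, ha⟩ : E) ∣ q + 1 := hexpE ▸ Monoid.order_dvd_exponent _
      rw [orderOf_mk, hor, ← hg, hk] at this
      have := Nat.le_of_dvd (by omega) this
      nlinarith
    rw [hE, hG] at hle2
    nlinarith
  · have : IsCyclic G := isCyclic_of_orderOf_eq_card g (hk.trans hG.symm)
    exact hcyc inferInstance

/-- A non-cyclic subgroup of order `p ^ 2` is the whole group. -/
theorem PhiDivisible.eq_top_of_card_eq_prime_sq {G : Type*} [Group G] [Finite G]
    (h : PhiDivisible G) {p : ℕ} [hp : Fact p.Prime] (hG : IsPGroup p G) {E : Subgroup G}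
    (hE : Nat.card E = p ^ 2) (hcyc : ¬ IsCyclic E) : E = ⊤ := by
  obtain ⟨n, hn⟩ := IsPGroup.iff_card.1 hG
  by_contra hne
  have hlt : p ^ 2 < p ^ n := by
    rw [← hn, ← hE]
    exact lt_of_le_of_ne (card_le_card_group E) fun h' => hne (eq_top_of_card_eq E h')
  have h3 : 3 ≤ n := (Nat.pow_lt_pow_iff_right hp.out.one_lt).1 hlt
  obtain ⟨H, hH, hEH⟩ := Sylow.exists_subgroup_card_pow_succ (hn ▸ pow_dvd_pow p h3) hE
  have := (h.subgroup H).isCyclic_of_card_eq_prime_sq_of_card_eq_prime_cube hH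
    (E := E.subgroupOf H) (by rw [Nat.card_congr (subgroupOfEquivOfLe hEH).toEquiv, hE])
  exact hcyc ((subgroupOfEquivOfLe hEH).isCyclic.1 this)


section MinimalNonCyclic

variable {M : Type*} [Group M] {p n : ℕ} [hp : Fact p.Prime]

/-- In a `p`-group all of whose proper subgroups are cyclic, elements outside of a given subgroup
of index `p` have order `p ^ n`, where the group has order `p ^ (n + 1)`. -/
theorem orderOf_eq_of_notMem_of_forall_isCyclic (hM : Nat.card M = p ^ (n + 1))
    (hnc : ¬ IsCyclic M) (hcyc : ∀ S : Subgroup M, S ≠ ⊤ → IsCyclic S) {C : Subgroup M}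
    [C.Normal] (hC : C.index = p) {u : M} (hu : u ∉ C) : orderOf u = p ^ n := by
  have : Finite M := Nat.finite_of_card_ne_zero (hM ▸ pow_ne_zero _ hp.out.ne_zero)
  obtain ⟨m, hm, hum⟩ := (Nat.dvd_prime_pow hp.out).1 (hM ▸ orderOf_dvd_natCard u)
  have hmn : m ≤ n := by
    by_contra hlt
    obtain rfl : m = n + 1 := by omega
    exact hnc (isCyclic_of_orderOf_eq_card u (hum.trans hM.symm))
  obtain ⟨D, hD, huD⟩ := Sylow.exists_subgroup_card_pow_prime_le p
    (hM ▸ pow_dvd_pow p n.le_succ) (zpowers u) ((Nat.card_zpowers u).trans hum) hmn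
  have hDtop : D ≠ ⊤ := by
    rintro rfl
    rw [card_top, hM] at hD
    exact absurd (Nat.pow_right_injective hp.out.two_le hD) (by omega)
  have := hcyc D hDtop
  obtain ⟨v, rfl⟩ := (Subgroup.isCyclic_iff_exists_zpowers_eq_top D).1 this
  rw [zpowers_le] at huD
  obtain ⟨k, rfl⟩ := mem_powers_iff_mem_zpowers.2 huD
  rw [Nat.card_zpowers] at hD
  by_cases hpk : p ∣ k
  · obtain ⟨j, rfl⟩ := hpk
    refine absurd ?_ hu
    simp only [pow_mul]
    exact pow_mem (hC ▸ C.pow_index_mem _) _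
  · simp only
    rw [Nat.Coprime.orderOf_pow _, hD]
    rw [hD]
    exact ((Nat.Prime.coprime_iff_not_dvd hp.out).2 hpk).pow_left _

theorem normal_of_index_eq_prime (hM : Nat.card M = p ^ (n + 1)) {C : Subgroup M}
    (hC : C.index = p) : C.Normal :=
  normal_of_index_eq_minFac_card (by rw [hC, hM, hp.out.pow_minFac n.succ_ne_zero])

theorem mul_pow_of_mul_eq_mul_mul {v w d : M} (h : w * v = v * w * d) (hvd : Commute v d)
    (hwd : Commute w d) (m : ℕ) : (v * w) ^ m = v ^ m * w ^ m * d ^ (m.choose 2) := by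
  have hw (m : ℕ) : w ^ m * v = v * w ^ m * d ^ m := by
    induction m with
    | zero => simp
    | succ m ih =>
      calc w ^ (m + 1) * v = w * (w ^ m * v) := by rw [pow_succ']; group
        _ = w * v * w ^ m * d ^ m := by rw [ih]; group
        _ = v * w * (d * w ^ m) * d ^ m := by rw [h]; group
        _ = v * w * (w ^ m * d) * d ^ m := by rw [(hwd.pow_left m).eq]
        _ = v * w ^ (m + 1) * d ^ (m + 1) := by rw [pow_succ' w, pow_succ' d]; group
  induction m with
  | zero => simp
  | succ m ih =>
    have hd : Commute (d ^ m.choose 2) (v * w) := ((hvd.mul_left hwd).pow_right _).symm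
    calc (v * w) ^ (m + 1) = v ^ m * w ^ m * (d ^ m.choose 2 * (v * w)) := by
          rw [pow_succ, ih]; group
      _ = v ^ m * (w ^ m * v) * w * d ^ m.choose 2 := by rw [hd.eq]; group
      _ = v ^ (m + 1) * w ^ m * (d ^ m * w) * d ^ m.choose 2 := by rw [hw, pow_succ v]; group
      _ = v ^ (m + 1) * w ^ m * (w * d ^ m) * d ^ m.choose 2 := by
          rw [((hwd.pow_right m).symm).eq]
      _ = _ := by
          rw [Nat.choose_succ_succ' m 1, Nat.choose_one_right, pow_add d, pow_succ w]; group

/-- A group of order eight generated by a pair of elements satisfying the quaternion relations. -/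
theorem nonempty_mulEquiv_quaternionGroup_two (hM : Nat.card M = 8) {v w : M}
    (hw : orderOf w = 4) (hv : v ∉ zpowers w) (hvw : v ^ 2 = w ^ 2) (h : w * v = v * w⁻¹) :
    Nonempty (M ≃* QuaternionGroup 2) := by
  have : Finite M := Nat.finite_of_card_ne_zero (by omega)
  let W : ZMod (2 * 2) → M := fun i => w ^ i.val
  have hWmem (i) : W i ∈ zpowers w := pow_mem (mem_zpowers w) _
  have hadd (i j) : W (i + j) = W i * W j := by
    simp only [W]
    rw [ZMod.val_add, ← pow_add, ← pow_mod_orderOf w (i.val + j.val), hw]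
  have hW0 : W 0 = 1 := by simp [W]
  have hsub (i j) : W (i - j) = W i * (W j)⁻¹ := by
    rw [eq_mul_inv_iff_mul_eq, ← hadd, sub_add_cancel]
  have hcomm (i j) : (W i)⁻¹ * W j = W j * (W i)⁻¹ := by
    refine Commute.inv_left ?_
    rw [Commute, SemiconjBy, ← hadd, add_comm, hadd]
  have hW2 : W ((2 : ℕ) : ZMod (2 * 2)) = v * v := (sq v ▸ hvw).symm
  have hconj (i) : W i * v = v * (W i)⁻¹ := by
    have h1 : SemiconjBy v w⁻¹ w := h.symm
    have h2 := h1.pow_right i.val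
    rw [inv_pow] at h2
    exact h2.symm
  have hinjW : Function.Injective W := fun i j hij =>
    ZMod.val_injective (2 * 2) <| pow_injOn_Iio_orderOf
      (Set.mem_Iio.2 (hw ▸ ZMod.val_lt i)) (Set.mem_Iio.2 (hw ▸ ZMod.val_lt j)) hij
  let f : QuaternionGroup 2 →* M :=
    { toFun := fun
        | .a i => W i
        | .xa i => v * W i
      map_one' := hW0
      map_mul' := by
        rintro (i | i) (j | j)
        · exact hadd i j
        · change v * W (j - i) = W i * (v * W j)
          rw [← mul_assoc, hconj, hsub, mul_assoc, hcomm]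
        · change v * W (i + j) = v * W i * W j
          rw [hadd, mul_assoc]
        · change W ((2 : ℕ) + j - i) = v * W i * (v * W j)
          rw [mul_assoc v, ← mul_assoc (W i), hconj, hsub, hadd, hW2, mul_assoc v (W i)⁻¹, hcomm]
          group }
  have hf : Function.Injective f := by
    rintro (i | i) (j | j) hij
    · exact congrArg _ (hinjW hij)
    · change W i = v * W j at hij
      exact absurd ((mul_mem_cancel_right (hWmem j)).1 (hij ▸ hWmem i)) hv
    · change v * W i = W j at hij
      exact absurd ((mul_mem_cancel_right (hWmem i)).1 (hij ▸ hWmem j)) hv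
    · exact congrArg _ (hinjW (mul_left_cancel hij))
  have hb : Function.Bijective f := (Nat.bijective_iff_injective_and_card f).2
    ⟨hf, by rw [hM, Nat.card_eq_fintype_card, QuaternionGroup.card]⟩
  exact ⟨(MulEquiv.ofBijective f hb).symm⟩

/-- A non-cyclic `p`-group all of whose proper subgroups are cyclic has order `p ^ 2` or is the
quaternion group. -/
theorem card_eq_or_nonempty_mulEquiv_of_forall_isCyclic (hM : Nat.card M = p ^ (n + 1))
    (hnc : ¬ IsCyclic M) (hcyc : ∀ S : Subgroup M, S ≠ ⊤ → IsCyclic S) :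
    n = 1 ∨ p = 2 ∧ Nonempty (M ≃* QuaternionGroup 2) := by
  have : Finite M := Nat.finite_of_card_ne_zero (hM ▸ pow_ne_zero _ hp.out.ne_zero)
  have hindex {D : Subgroup M} (hD : Nat.card D = p ^ n) : D.index = p := by
    have := D.card_mul_index
    rw [hM, hD, pow_succ] at this
    exact Nat.eq_of_mul_eq_mul_left (pow_pos hp.out.pos n) this
  have hn0 : n ≠ 0 := by
    rintro rfl
    exact hnc (isCyclic_of_prime_card (hM.trans (pow_one p)))
  obtain ⟨C, hC⟩ := Sylow.exists_subgroup_card_pow_prime p (hM ▸ pow_dvd_pow p n.le_succ)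
  have hCi := hindex hC
  have := normal_of_index_eq_prime hM hCi
  have hCtop : C ≠ ⊤ := by
    rintro rfl
    exact hp.out.one_lt.ne (index_top.symm.trans hCi)
  have hCcyc := hcyc C hCtop
  obtain ⟨x, rfl⟩ := (Subgroup.isCyclic_iff_exists_zpowers_eq_top C).1 hCcyc
  have hout {u : M} (hu : u ∉ zpowers x) : orderOf u = p ^ n :=
    orderOf_eq_of_notMem_of_forall_isCyclic hM hnc hcyc hCi hu
  obtain ⟨y, hy⟩ : ∃ y, y ∉ zpowers x := by
    by_contra! hall
    exact hCtop (eq_top_iff.2 fun u _ => hall u)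
  have hyo := hout hy
  have hyi := hindex ((Nat.card_zpowers y).trans hyo)
  have := normal_of_index_eq_prime hM hyi
  have hxo : orderOf x = p ^ n := (Nat.card_zpowers x).symm.trans hC
  have hypx : y ^ p ∈ zpowers x := by simpa only [hCi] using (zpowers x).pow_index_mem y
  obtain ⟨k, hk⟩ := mem_powers_iff_mem_zpowers.2 hypx
  simp only at hk
  obtain ⟨j, rfl⟩ : p ∣ k := by
    by_contra hpk
    have h1 : orderOf (x ^ k) = p ^ n := by
      rw [Nat.Coprime.orderOf_pow _, hxo]
      rw [hxo]
      exact ((Nat.Prime.coprime_iff_not_dvd hp.out).2 hpk).pow_left _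
    rw [hk, orderOf_pow, hyo, Nat.gcd_eq_right (dvd_pow_self p hn0)] at h1
    exact absurd h1 (Nat.div_lt_self (pow_pos hp.out.pos n) hp.out.one_lt).ne
  rw [mul_comm, pow_mul] at hk
  set w := x ^ j with hw
  have hwx : w ∈ zpowers x := pow_mem (mem_zpowers x) j
  have hvx : y⁻¹ ∉ zpowers x := by rwa [inv_mem_iff]
  have hvwx : y⁻¹ * w ∉ zpowers x := fun hmem => hvx ((mul_mem_cancel_right hwx).1 hmem)
  set d := w⁻¹ * (y * w * y⁻¹) with hd
  have hdx : d ∈ zpowers x :=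
    mul_mem (inv_mem hwx) ((inferInstance : (zpowers x).Normal).conj_mem w hwx y)
  have hdy : d ∈ zpowers y := by
    have h1 := (inferInstance : (zpowers y).Normal).conj_mem y (mem_zpowers y) w⁻¹
    rw [hd, show w⁻¹ * (y * w * y⁻¹) = w⁻¹ * y * w⁻¹⁻¹ * y⁻¹ by group]
    exact mul_mem h1 (inv_mem (mem_zpowers y))
  have hwd : Commute w d := by
    obtain ⟨i, hi⟩ := hdx
    simp only at hi
    rw [← hi]
    exact ((Commute.refl x).pow_left j).zpow_right i
  have hyd : Commute y d := by
    obtain ⟨i, hi⟩ := hdy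
    simp only at hi
    rw [← hi]
    exact (Commute.refl y).zpow_right i
  have hrel : w * y⁻¹ = y⁻¹ * w * d := by rw [hd]; group
  have hdp : d ^ p = 1 := by
    have h1 : (w * d) ^ p = w ^ p := by
      rw [hd, show w * (w⁻¹ * (y * w * y⁻¹)) = y * w * y⁻¹ by group, conj_pow, hk,
        ← pow_succ', pow_succ]
      group
    rwa [hwd.mul_pow, mul_eq_left] at h1
  have hpow := mul_pow_of_mul_eq_mul_mul hrel hyd.inv_left hwd
  have hcancel (m : ℕ) : (y⁻¹) ^ (p * m) * w ^ (p * m) = 1 := by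
    rw [pow_mul w, hk, ← pow_mul, inv_pow, inv_mul_cancel]
  rcases hp.out.eq_two_or_odd' with rfl | hodd
  · refine or_iff_not_imp_left.2 fun hn1 => ⟨rfl, ?_⟩
    have h4 : (y⁻¹ * w) ^ 4 = 1 := by
      rw [hpow, show Nat.choose 4 2 = 2 * 3 from rfl, pow_mul d, hdp, one_pow, mul_one]
      exact hcancel 2
    have hdvd := orderOf_dvd_of_pow_eq_one h4
    rw [hout hvwx, show 4 = 2 ^ 2 from rfl, Nat.pow_dvd_pow_iff_le_right one_lt_two] at hdvd
    obtain rfl : n = 2 := by omega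
    have hd1 : d ≠ 1 := fun hd1 => by
      have h2 := hpow 2
      have h3 := hcancel 1
      rw [mul_one] at h3
      rw [h3, hd1, one_pow, one_mul] at h2
      have h5 := orderOf_dvd_of_pow_eq_one h2
      rw [hout hvwx] at h5
      exact absurd h5 (by decide)
    have hwo : orderOf w = 2 ^ 2 := by
      refine orderOf_eq_prime_pow ?_ ?_
      · rw [pow_one, hk]
        exact fun h => absurd (orderOf_dvd_of_pow_eq_one h) (by rw [hyo]; decide)
      · rw [pow_succ, pow_one, pow_mul, hk, ← pow_mul]
        exact orderOf_dvd_iff_pow_eq_one.1 (by rw [hyo]; decide)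
    have hwz : zpowers w = zpowers x := eq_of_le_of_card_ge (zpowers_le.2 hwx)
      (by rw [Nat.card_zpowers, Nat.card_zpowers, hwo, hxo])
    have hdw : d = w ^ 2 := by
      obtain ⟨i, hi⟩ := mem_powers_iff_mem_zpowers.2 (hwz ▸ hdx)
      simp only at hi
      rw [← pow_mod_orderOf, hwo] at hi
      rw [← hi] at hd1 hdp ⊢
      have hlt : i % 2 ^ 2 < 4 := Nat.mod_lt _ (by decide)
      rw [← pow_mul] at hdp
      have hdiv := orderOf_dvd_of_pow_eq_one hdp
      rw [hwo] at hdiv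
      generalize i % 2 ^ 2 = r at *
      interval_cases r
      · simp at hd1
      · omega
      · rfl
      · omega
    refine nonempty_mulEquiv_quaternionGroup_two hM hwo (hwz ▸ hvx) ?_ ?_
    · rw [hk, inv_pow, inv_eq_iff_mul_eq_one, ← pow_add]
      exact orderOf_dvd_iff_pow_eq_one.1 (by rw [hyo]; decide)
    · rw [hrel, mul_assoc, hdw, ← pow_succ', ← mul_right_inj (y : M)]
      rw [mul_inv_cancel_left, mul_inv_cancel_left, eq_inv_iff_mul_eq_one, ← pow_succ]
      exact orderOf_dvd_iff_pow_eq_one.1 (by rw [hwo]; decide)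
  · left
    have h1 : (y⁻¹ * w) ^ p = 1 := by
      have h2 : p ∣ p.choose 2 := hp.out.dvd_choose_self two_ne_zero
        (lt_of_le_of_ne hp.out.two_le fun h => by subst h; exact absurd hodd (by decide))
      obtain ⟨i, hi⟩ := h2
      have h3 := hcancel 1
      rw [mul_one] at h3
      rw [hpow, h3, hi, pow_mul, hdp, one_pow, mul_one]
    have h4 := orderOf_dvd_of_pow_eq_one h1
    rw [hout hvwx, ← pow_one p, ← pow_mul, Nat.pow_dvd_pow_iff_le_right hp.out.one_lt] at h4
    omega

end MinimalNonCyclic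

section ElementaryAbelian

variable {G : Type*} [Group G] {p : ℕ} [hp : Fact p.Prime] {s t : G}

theorem disjoint_zpowers_of_orderOf_eq_prime (ht : orderOf t = p)
    (hst : t ∉ zpowers s) : Disjoint (zpowers s) (zpowers t) := by
  rw [disjoint_def]
  intro x hxs hxt
  by_contra hx
  have : Finite (zpowers t) := Nat.finite_of_card_ne_zero
    (by rw [Nat.card_zpowers, ht]; exact hp.out.ne_zero)
  have hxo : orderOf x = p := ((Nat.dvd_prime hp.out).1 (ht ▸ orderOf_dvd_of_mem_zpowers hxt)
    ).resolve_left (by rwa [orderOf_eq_one_iff])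
  have hxt' : zpowers x = zpowers t := eq_of_le_of_card_ge (zpowers_le.2 hxt)
    (by rw [Nat.card_zpowers, Nat.card_zpowers, hxo, ht])
  exact hst (zpowers_le.2 hxs (hxt' ▸ mem_zpowers t))

theorem exists_injective_hom_of_orderOf_eq_prime (ht : orderOf t = p)
    (hst : t ∉ zpowers s) (hcomm : Commute s t) :
    ∃ f : zpowers s × zpowers t →* G, Function.Injective f := by
  have hc (m : zpowers s) (n : zpowers t) :
      Commute ((zpowers s).subtype m) ((zpowers t).subtype n) := by
    obtain ⟨_, i, rfl⟩ := m
    obtain ⟨_, j, rfl⟩ := n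
    exact hcomm.zpow_zpow i j
  refine ⟨MonoidHom.noncommCoprod _ _ hc, (MonoidHom.noncommCoprod_injective _ _ hc).2
    ⟨subtype_injective _, subtype_injective _, ?_⟩⟩
  rw [range_subtype, range_subtype]
  exact disjoint_zpowers_of_orderOf_eq_prime ht hst

theorem nonempty_mulEquiv_zmod_prod_of_card_eq_prime_sq (hG : Nat.card G = p ^ 2)
    (hcyc : ¬ IsCyclic G) :
    Nonempty (G ≃* (Multiplicative (ZMod p) × Multiplicative (ZMod p))) := by
  have : Finite G := Nat.finite_of_card_ne_zero (hG ▸ pow_ne_zero 2 hp.out.ne_zero)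
  have : Nontrivial G := Finite.one_lt_card_iff_nontrivial.1
    (hG ▸ one_lt_pow₀ hp.out.one_lt two_ne_zero)
  have hord := (Monoid.exponent_eq_prime_iff hp.out).1
    ((not_isCyclic_iff_exponent_eq_prime hp.out hG).1 hcyc)
  have hcomm := (IsPGroup.isMulCommutative_of_card_eq_prime_sq hG).is_comm.comm
  obtain ⟨s, hs⟩ := exists_ne (1 : G)
  obtain ⟨t, hst⟩ : ∃ t, t ∉ zpowers s := by
    by_contra! hall
    exact hcyc ⟨s, hall⟩
  have ht : t ≠ 1 := by
    rintro rfl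
    exact hst (one_mem _)
  have hs' := hord s hs
  have ht' := hord t ht
  obtain ⟨f, hf⟩ := exists_injective_hom_of_orderOf_eq_prime ht' hst (hcomm s t)
  have hb : Function.Bijective f := (Nat.bijective_iff_injective_and_card f).2
    ⟨hf, by rw [Nat.card_prod, Nat.card_zpowers, Nat.card_zpowers, hs', ht', hG, sq]⟩
  have key (u : G) (hu : orderOf u = p) : zpowers u ≃* Multiplicative (ZMod p) :=
    mulEquivOfPrimeCardEq (p := p) (by rw [Nat.card_zpowers, hu]) (by simp)
  exact ⟨(MulEquiv.ofBijective f hb).symm.trans ((key s hs').prodCongr (key t ht'))⟩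

theorem PhiDivisible.card_eq_prime_sq_of_commute [Finite G] (h : PhiDivisible G)
    (hG : IsPGroup p G) (hs : orderOf s = p) (ht : orderOf t = p) (hst : t ∉ zpowers s)
    (hcomm : Commute s t) : Nat.card G = p ^ 2 := by
  obtain ⟨f, hf⟩ := exists_injective_hom_of_orderOf_eq_prime ht hst hcomm
  let e := MonoidHom.ofInjective hf
  have hcard : Nat.card f.range = p ^ 2 := by
    rw [← Nat.card_congr e.toEquiv, Nat.card_prod, Nat.card_zpowers, Nat.card_zpowers, hs, ht, sq]
  have hcyc : ¬ IsCyclic f.range := fun hc => by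
    have h1 := (Group.isCyclic_prod_iff.1 (e.isCyclic.2 hc)).2.2
    rw [Nat.card_zpowers, Nat.card_zpowers, hs, ht, Nat.coprime_self] at h1
    exact hp.out.ne_one h1
  rw [← hcard, h.eq_top_of_card_eq_prime_sq hG hcard hcyc, card_top]

end ElementaryAbelian

theorem phi_quaternionGroup_two : phi (QuaternionGroup 2) = 6 := by
  have h (a : QuaternionGroup 2) : orderOf a = Monoid.exponent (QuaternionGroup 2) ↔ a ^ 2 ≠ 1 := by
    rw [QuaternionGroup.exponent, show 2 * lcm 2 2 = 2 ^ (1 + 1) from rfl]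
    refine ⟨fun ha h2 => absurd (orderOf_dvd_of_pow_eq_one h2) (by rw [ha]; decide),
      fun ha => orderOf_eq_prime_pow (by simpa using ha) ?_⟩
    revert a
    decide
  unfold phi
  rw [Nat.card_congr (Equiv.subtypeEquivRight h), Nat.card_eq_fintype_card]
  decide

theorem not_isMulCommutative_quaternionGroup_two : ¬ IsMulCommutative (QuaternionGroup 2) :=
  fun h => absurd (h.is_comm.comm (.a 1) (.xa 0)) (by decide)

theorem PhiDivisible.not_nonempty_mulEquiv_quaternionGroup_two {G : Type*} [Group G]
    (h : PhiDivisible G) (hG : Nat.card G = 2 ^ 4) (M : Subgroup G) :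
    ¬ Nonempty (M ≃* QuaternionGroup 2) := by
  rintro ⟨e⟩
  have : Finite G := Nat.finite_of_card_ne_zero (hG ▸ by decide)
  have hp : IsPGroup 2 G := IsPGroup.of_card hG
  have hM : Nat.card M = 8 := by
    rw [Nat.card_congr e.toEquiv, Nat.card_eq_fintype_card, QuaternionGroup.card]
  have hexp : Monoid.exponent M = 4 := by
    rw [Monoid.exponent_eq_of_mulEquiv e, QuaternionGroup.exponent]; rfl
  have h6 : 6 ∣ phi G := phi_quaternionGroup_two ▸ phi_congr e ▸ h.phi_dvd M
  have h4 : 4 ∣ Monoid.exponent G :=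
    hexp ▸ Monoid.exponent_dvd_of_monoidHom M.subtype M.subtype_injective
  have hpos := h.phi_pos
  obtain ⟨g, hg⟩ := h.exists_orderOf_eq_exponent
  obtain ⟨k, hk4, hk⟩ := (Nat.dvd_prime_pow Nat.prime_two).1 (hG ▸ orderOf_dvd_natCard g)
  rw [← hg, hk] at h4
  interval_cases k
  · omega
  · omega
  · have : Nontrivial G := Finite.one_lt_card_iff_nontrivial.1 (hG ▸ by decide)
    have : Nontrivial (center G) := hp.center_nontrivial
    obtain ⟨z, hz⟩ := exists_prime_orderOf_dvd_card' (G := center G) 2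
      ((hp.to_subgroup _).card_eq_or_dvd.resolve_left (Finite.one_lt_card.ne'))
    have hz' : orderOf (z : G) = 2 := by rw [orderOf_coe, hz]
    have hle : ∀ t : G, t ∉ zpowers (z : G) ↔ orderOf t = Monoid.exponent G := by
      intro t
      rw [← hg, hk]
      refine ⟨fun ht => ?_, fun ht hmem => ?_⟩
      · obtain ⟨i, hi⟩ := IsPGroup.iff_orderOf.1 hp t
        have hdvd : orderOf t ∣ 2 ^ 2 := hk ▸ hg ▸ Monoid.order_dvd_exponent t
        have hi2 : i ≤ 2 := (Nat.pow_dvd_pow_iff_le_right one_lt_two).1 (hi ▸ hdvd)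
        interval_cases i
        · rw [pow_zero, orderOf_eq_one_iff] at hi
          exact absurd (hi ▸ one_mem _) ht
        · have := h.card_eq_prime_sq_of_commute hp hz' hi ht (mem_center_iff.1 z.2 t).symm
          omega
        · exact hi
      · have := orderOf_dvd_of_mem_zpowers hmem
        rw [ht, hz'] at this
        omega
    have hphi : phi G + 2 = 16 := by
      classical
      unfold phi
      rw [← Nat.card_congr (Equiv.subtypeEquivRight hle), ← hz', ← Nat.card_zpowers, add_comm,
        ← Nat.card_sum]
      exact (Nat.card_congr (Equiv.sumCompl (· ∈ zpowers (z : G)))).trans hG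
    omega
  · have h1 := phi_add_card_le M fun a ha hor => by
      have : orderOf (⟨a, ha⟩ : M) ∣ 4 := hexp ▸ Monoid.order_dvd_exponent _
      rw [orderOf_mk, hor, ← hg, hk] at this
      omega
    have h2 := h.totient_orderOf_dvd g
    rw [hk, Nat.totient_prime_pow Nat.prime_two (by decide)] at h2
    omega
  · have : IsCyclic G := isCyclic_of_orderOf_eq_card g (hk.trans hG.symm)
    have : IsCyclic (QuaternionGroup 2) := e.isCyclic.1 inferInstance
    exact not_isMulCommutative_quaternionGroup_two inferInstance

theorem PhiDivisible.isCyclic_or_of_isPGroup {G : Type*} [Group G] [Finite G]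
    (h : PhiDivisible G) {p : ℕ} [hp : Fact p.Prime] (hG : IsPGroup p G) :
    IsCyclic G ∨ Nonempty (G ≃* QuaternionGroup 2) ∨
      Nonempty (G ≃* (Multiplicative (ZMod p) × Multiplicative (ZMod p))) := by
  refine or_iff_not_imp_left.2 fun hnc => ?_
  obtain ⟨M, hMnc, hMmin⟩ := wellFounded_lt.has_min {M : Subgroup G | ¬ IsCyclic M}
    ⟨⊤, fun hc => hnc (topEquiv.isCyclic.1 hc)⟩
  have hcyc (S : Subgroup M) (hS : S ≠ ⊤) : IsCyclic S := by
    by_contra hSc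
    have hSc' : ¬ IsCyclic (S.map M.subtype) := fun hc =>
      hSc ((S.equivMapOfInjective _ M.subtype_injective).isCyclic.2 hc)
    refine hMmin _ hSc' (lt_of_le_of_ne (map_subtype_le S) fun heq => hS ?_)
    rw [eq_top_iff, ← map_le_map_iff_of_injective M.subtype_injective, heq]
    exact map_subtype_le _
  obtain ⟨m, hm⟩ := IsPGroup.iff_card.1 (hG.to_subgroup M)
  obtain ⟨n, rfl⟩ : ∃ n, m = n + 1 := Nat.exists_eq_succ_of_ne_zero <| by
    rintro rfl
    have : Subsingleton M := Finite.card_le_one_iff_subsingleton.1 (by rw [hm, pow_zero])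
    exact hMnc inferInstance
  rcases card_eq_or_nonempty_mulEquiv_of_forall_isCyclic hm hMnc hcyc with rfl | ⟨rfl, ⟨e⟩⟩
  · right
    have htop := h.eq_top_of_card_eq_prime_sq hG hm hMnc
    rw [htop, card_top] at hm
    exact nonempty_mulEquiv_zmod_prod_of_card_eq_prime_sq hm hnc
  · left
    have hM8 : Nat.card M = 2 ^ 3 := by
      rw [Nat.card_congr e.toEquiv, Nat.card_eq_fintype_card, QuaternionGroup.card]; rfl
    by_cases htop : M = ⊤
    · subst htop
      exact ⟨topEquiv.symm.trans e⟩
    · obtain ⟨N, hN⟩ := IsPGroup.iff_card.1 hG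
      have hlt : 2 ^ 3 < 2 ^ N := by
        rw [← hN, ← hM8]
        exact lt_of_le_of_ne (card_le_card_group M) fun h' => htop (eq_top_of_card_eq M h')
      have h4 : 3 + 1 ≤ N := (Nat.pow_lt_pow_iff_right one_lt_two).1 hlt
      obtain ⟨H, hH, hMH⟩ := Sylow.exists_subgroup_card_pow_succ (hN ▸ pow_dvd_pow 2 h4) hM8
      exact ((h.subgroup H).not_nonempty_mulEquiv_quaternionGroup_two hH (M.subgroupOf H)
        ⟨(subgroupOfEquivOfLe hMH).trans e⟩).elim


section Nilpotent

theorem orderOf_dvd_of_conj_eq_mul {G : Type*} [Group G] {b v c : G} (h : v⁻¹ * b * v = c * b)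
    (hc : Commute c b) : orderOf c ∣ orderOf b := by
  apply orderOf_dvd_of_pow_eq_one
  have h1 : (v⁻¹ * b * v⁻¹⁻¹) ^ orderOf b = 1 := by rw [conj_pow, pow_orderOf_eq_one]; group
  rwa [inv_inv, h, hc.mul_pow, pow_orderOf_eq_one, mul_one] at h1

theorem commute_of_conj_eq_mul {G : Type*} [Group G] {b v c : G} {n : ℕ}
    (h : v⁻¹ * b * v = c * b) (hc : Commute c b) (hbn : (orderOf b).Coprime n)
    (hcn : orderOf c ∣ n) : Commute b v := by
  have hc1 : c = 1 := orderOf_eq_one_iff.1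
    (Nat.eq_one_of_dvd_coprimes hbn (orderOf_dvd_of_conj_eq_mul h hc) hcn)
  rwa [hc1, one_mul, mul_assoc, inv_mul_eq_iff_eq_mul] at h

theorem commute_of_coprime_orderOf (G : Type*) [Group G] [Group.IsNilpotent G] :
    ∀ x y : G, (orderOf x).Coprime (orderOf y) → Commute x y := by
  refine Group.nilpotent_center_quotient_ind
    (P := fun G _ _ => ∀ x y : G, (orderOf x).Coprime (orderOf y) → Commute x y) G
    (fun G _ _ x y _ => Subsingleton.elim _ _) ?_
  intro G _ _ ih x y hxy
  have hq := ih (QuotientGroup.mk' (center G) x) (QuotientGroup.mk' (center G) y)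
    ((hxy.coprime_dvd_left (orderOf_map_dvd _ x)).coprime_dvd_right (orderOf_map_dvd _ y))
  rw [Commute, SemiconjBy, ← map_mul, ← map_mul, QuotientGroup.mk'_eq_mk'] at hq
  obtain ⟨c, hc, hcxy⟩ := hq
  have hcx : Commute c x := (mem_center_iff.1 hc x).symm
  have hcy : Commute c y := (mem_center_iff.1 hc y).symm
  have h1 : x⁻¹ * y * x = c * y := by
    rw [mul_assoc, ← hcxy, hcy.eq]
    group
  have h2 : y⁻¹ * x * y = c⁻¹ * x := by
    rw [mul_assoc, inv_mul_eq_iff_eq_mul, hcx.inv_left.eq, ← mul_assoc, ← hcxy]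
    group
  refine (commute_of_conj_eq_mul h1 hcy hxy.symm ?_).symm
  rw [← orderOf_inv]
  exact orderOf_dvd_of_conj_eq_mul h2 hcx.inv_left

variable {G : Type*} [Group G]

theorem commute_of_coprime_orderOf_of_mem (H : Subgroup G) [Group.IsNilpotent H] {x y : G}
    (hx : x ∈ H) (hy : y ∈ H) (hxy : (orderOf x).Coprime (orderOf y)) : Commute x y := by
  have h := commute_of_coprime_orderOf H ⟨x, hx⟩ ⟨y, hy⟩ (by rwa [orderOf_mk, orderOf_mk])
  exact congrArg Subtype.val h

theorem commute_of_quaternionGroup_two_of_normal (Q : Subgroup G) [Q.Normal]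
    (e : Q ≃* QuaternionGroup 2) {b z : G} (hb : (orderOf b).Coprime 2)
    (hz : z ∈ Q) (hz4 : orderOf z = 4) (hbz : Commute b z) {v : G} (hv : v ∈ Q) :
    Commute b v := by
  have hi : (zpowers (⟨z, hz⟩ : Q)).index = 2 := by
    have h1 := card_mul_index (zpowers (⟨z, hz⟩ : Q))
    rw [Nat.card_zpowers, orderOf_mk, hz4, Nat.card_congr e.toEquiv, Nat.card_eq_fintype_card,
      QuaternionGroup.card] at h1
    omega
  have hmem : (⟨v, hv⟩ : Q) ∈ zpowers (⟨z, hz⟩ : Q) ↔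
      (⟨b * v * b⁻¹, Normal.conj_mem inferInstance v hv b⟩ : Q) ∈ zpowers (⟨z, hz⟩ : Q) := by
    simp only [mem_zpowers_iff, Subtype.ext_iff, coe_zpow]
    refine exists_congr fun k => ?_
    rw [eq_mul_inv_iff_mul_eq, ← (hbz.zpow_right k).eq, mul_left_cancel_iff]
  have hc := (mul_mem_iff_of_index_two hi).2 (inv_mem_iff.trans hmem)
  obtain ⟨k, hk⟩ := mem_zpowers_iff.1 hc
  have hk' : z ^ k = v⁻¹ * (b * v * b⁻¹) := congrArg Subtype.val hk
  have hvb : v⁻¹ * b * v = z ^ k * b := by rw [hk']; group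
  refine commute_of_conj_eq_mul hvb (hbz.zpow_right k).symm (hb.pow_right 2) ?_
  exact (orderOf_dvd_of_mem_zpowers ⟨k, rfl⟩).trans hz4.dvd

variable [Finite G]

theorem eq_top_of_forall_exists_sylow_le (H : Subgroup G)
    (hH : ∀ (r : ℕ) (_ : Fact r.Prime), ∃ R : Sylow r G, ↑R ≤ H) : H = ⊤ := by
  rw [← index_eq_one]
  refine Nat.eq_one_iff_not_exists_prime_dvd.2 fun r hr hdvd => ?_
  have := Fact.mk hr
  obtain ⟨R, hR⟩ := hH r this
  exact R.not_dvd_index (hdvd.trans (index_dvd_of_le hR))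

theorem mem_sylow_of_orderOf_eq_pow {q : ℕ} [Fact q.Prime] (Q : Sylow q G)
    [hQ : (Q : Subgroup G).Normal] {z : G} {k : ℕ} (hz : orderOf z = q ^ k) : z ∈ Q := by
  have hp : IsPGroup q (zpowers z) := IsPGroup.of_card (n := k) (by rw [Nat.card_zpowers, hz])
  obtain ⟨R, hR⟩ := hp.exists_le_sylow
  have := Sylow.unique_of_normal Q hQ
  rw [Subsingleton.elim Q R]
  exact hR (mem_zpowers z)

theorem sylow_normal_of_sylow_not_normal {p : ℕ} [hp : Fact p.Prime]
    (h : ∀ H : Subgroup G, H ≠ ⊤ → Group.IsNilpotent H)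
    (P : Sylow p G) (hPc : IsMulCommutative P) (hPn : ¬ (P : Subgroup G).Normal) {q : ℕ}
    [hq : Fact q.Prime] (hqp : q ≠ p) (Q : Sylow q G) : (Q : Subgroup G).Normal := by
  set N := normalizer ((P : Subgroup G) : Set G) with hN
  have hNt : N ≠ ⊤ := fun ht => hPn (normalizer_eq_top_iff.1 ht)
  have := h N hNt
  have hPN : (P : Subgroup G) ≤ N := le_normalizer
  have hC : N ≤ centralizer (P : Set G) := by
    rw [← subgroupOf_eq_top]
    refine eq_top_of_forall_exists_sylow_le _ fun r hr => ?_
    by_cases hrp : r = p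
    · subst hrp
      refine ⟨P.subtype hPN, ?_⟩
      rw [Sylow.coe_subtype]
      refine fun x hx y hy => ?_
      exact congrArg Subtype.val (hPc.is_comm.comm ⟨y, hy⟩ ⟨x, hx⟩)
    · obtain ⟨R⟩ : Nonempty (Sylow r N) := inferInstance
      refine ⟨R, fun x hx => ?_⟩
      refine fun y hy => ?_
      obtain ⟨i, hi⟩ := IsPGroup.iff_orderOf.1 R.2 ⟨x, hx⟩
      obtain ⟨j, hj⟩ := IsPGroup.iff_orderOf.1 P.2 ⟨y, hy⟩
      rw [orderOf_mk] at hi hj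
      refine (commute_of_coprime_orderOf_of_mem N x.2 (hPN hy) ?_).symm
      rw [orderOf_coe, hi, hj]
      exact Nat.coprime_pow_primes _ _ hr.out hp.out hrp
  set K := (MonoidHom.transferSylow P hC).ker with hK
  have hKp := MonoidHom.not_dvd_card_ker_transferSylow P hC
  have hKt : K ≠ ⊤ := by
    intro ht
    rw [← hK, ht, card_top] at hKp
    have hc : Nat.card P = 1 := by
      obtain ⟨n, hn⟩ := IsPGroup.iff_card.1 P.2
      rcases n with _ | n
      · simpa using hn
      · exact absurd ((hn ▸ dvd_pow_self p n.succ_ne_zero).trans (card_subgroup_dvd_card _)) hKp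
    have hbot := eq_bot_of_card_eq _ hc
    rw [hbot] at hPn
    exact hPn inferInstance
  have hKnil := h K hKt
  have hQK : (Q : Subgroup G) ≤ K := by
    intro x hx
    rw [hK, MonoidHom.mem_ker]
    obtain ⟨i, hi⟩ := IsPGroup.iff_orderOf.1 Q.2 ⟨x, hx⟩
    rw [orderOf_mk] at hi
    obtain ⟨j, hj⟩ := IsPGroup.iff_orderOf.1 P.2 (MonoidHom.transferSylow P hC x)
    rw [← orderOf_eq_one_iff]
    refine Nat.eq_one_of_dvd_coprimes ?_ (hi ▸ orderOf_map_dvd _ x) hj.dvd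
    exact Nat.coprime_pow_primes _ _ hq.out hp.out hqp
  have hnorm : (Q.subtype hQK : Subgroup K).Normal := inferInstance
  have := Sylow.characteristic_of_normal _ hnorm
  rw [Sylow.coe_subtype] at this
  have hmap := ConjAct.normal_of_characteristic_of_normal (H := K)
    (K := (Q : Subgroup G).subgroupOf K)
  rwa [subgroupOf_map_subtype, inf_of_le_left hQK] at hmap

theorem commute_of_isMulCommutative_of_normal {q : ℕ} [hq : Fact q.Prime]
    (h : ∀ H : Subgroup G, H ≠ ⊤ → Group.IsNilpotent H) (Q : Subgroup G) [Q.Normal]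
    (hQ : IsPGroup q Q) (hQc : IsMulCommutative Q) {b z : G} (hb : orderOf b ∣ Q.index)
    (hbq : (orderOf b).Coprime q)
    (hz : z ∈ Q) (hz1 : z ≠ 1) (hbz : Commute b z) {v : G} (hv : v ∈ Q) : Commute b v := by
  have hcomm {s t : G} (hs : s ∈ Q) (ht : t ∈ Q) : s * t = t * s :=
    congrArg Subtype.val (hQc.is_comm.comm ⟨s, hs⟩ ⟨t, ht⟩)
  have hconj {s : G} (hs : s ∈ Q) : b * s * b⁻¹ ∈ Q := Normal.conj_mem inferInstance s hs b
  let f : Q →* G := MonoidHom.mk' (fun s => (s : G)⁻¹ * (b * s * b⁻¹)) fun s t => by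
    have := hcomm (Q.inv_mem t.2) (Q.mul_mem (Q.inv_mem s.2) (hconj s.2))
    rw [coe_mul, mul_inv_rev]
    calc _ = ((t : G)⁻¹ * ((s : G)⁻¹ * (b * s * b⁻¹))) * (b * t * b⁻¹) := by group
      _ = _ := by rw [this]; group
  have hf (s : Q) : f s = (s : G)⁻¹ * (b * s * b⁻¹) := rfl
  have hfQ : f.range ≤ Q := by
    rintro _ ⟨s, rfl⟩
    exact Q.mul_mem (Q.inv_mem s.2) (hconj s.2)
  have hlt : Nat.card f.range < Nat.card Q := by
    refine lt_of_le_of_ne (card_le_of_le hfQ) fun heq => ?_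
    have hbij := (Nat.bijective_iff_surjective_and_card f.rangeRestrict).2
      ⟨f.rangeRestrict_surjective, heq.symm⟩
    have h1 : f.rangeRestrict ⟨z, hz⟩ = f.rangeRestrict 1 := by
      refine Subtype.ext ?_
      rw [map_one, MonoidHom.coe_rangeRestrict, hf, OneMemClass.coe_one, hbz.eq]
      group
    exact hz1 (congrArg Subtype.val (hbij.1 h1))
  have hbn : b ∈ normalizer (f.range : Set G) := by
    refine mem_normalizer_fintype ?_
    rintro _ ⟨s, rfl⟩
    refine ⟨⟨b * s * b⁻¹, hconj s.2⟩, ?_⟩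
    simp only [hf]
    group
  have hJ : zpowers b ⊔ f.range ≠ ⊤ := by
    intro hJ
    have hn : f.range.Normal := by
      rw [← normalizer_eq_top_iff, eq_top_iff, ← hJ]
      exact sup_le (zpowers_le.2 hbn) le_normalizer
    have h1 : f.range.index ∣ Q.index := by
      rw [← relIndex_top_right, ← hJ, relIndex_sup_right]
      exact (relIndex_dvd_card _ _).trans (by rwa [Nat.card_zpowers])
    have h2 := Nat.le_of_dvd (Nat.pos_of_ne_zero FiniteIndex.index_ne_zero) h1
    have h3 := f.range.card_mul_index.trans Q.card_mul_index.symm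
    have h4 : 0 < f.range.index := Nat.pos_of_ne_zero FiniteIndex.index_ne_zero
    nlinarith
  have := h _ hJ
  have hc := hf ⟨v, hv⟩
  set c := f ⟨v, hv⟩
  obtain ⟨i, hi⟩ := IsPGroup.iff_orderOf.1 hQ ⟨c, hfQ ⟨_, rfl⟩⟩
  rw [orderOf_mk] at hi
  have hcb : Commute b c := commute_of_coprime_orderOf_of_mem _
    (mem_sup_left (mem_zpowers b)) (mem_sup_right (MonoidHom.mem_range.2 ⟨_, rfl⟩))
    (hi ▸ hbq.pow_right i)
  have hvb : v⁻¹ * b * v = c * b := by rw [hc]; group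
  exact commute_of_conj_eq_mul hvb hcb.symm (hbq.pow_right i) hi.dvd

theorem PhiDivisible.commute_of_sylow_normal {q : ℕ} [hq : Fact q.Prime] (h : PhiDivisible G)
    (hprop : ∀ H : Subgroup G, H ≠ ⊤ → Group.IsNilpotent H) (Q : Sylow q G)
    [hQn : (Q : Subgroup G).Normal] {x y : G} (hx : (orderOf x).Coprime q) (hy : y ∈ Q) :
    Commute x y := by
  obtain ⟨i, hi⟩ := IsPGroup.iff_orderOf.1 Q.2 ⟨y, hy⟩
  rw [orderOf_mk] at hi
  by_cases htop : zpowers x ⊔ Q = ⊤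
  swap
  · have := hprop _ htop
    exact commute_of_coprime_orderOf_of_mem _ (mem_sup_left (mem_zpowers x)) (mem_sup_right hy)
      (hi ▸ hx.pow_right i)
  by_cases hy1 : y = 1
  · exact hy1 ▸ Commute.one_right x
  obtain ⟨n, hn⟩ := IsPGroup.iff_card.1 Q.2
  have hcard := (Q : Subgroup G).card_mul_index
  have hindex : (Q : Subgroup G).index ∣ orderOf x := by
    rw [← relIndex_top_right, ← htop, relIndex_sup_right, ← Nat.card_zpowers]
    exact relIndex_dvd_card _ _
  obtain ⟨a, ha⟩ := h.exists_orderOf_eq_exponent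
  have hE : Monoid.exponent G ≠ 0 := Monoid.exponent_ne_zero_of_finite
  obtain ⟨e, m, hm, hem⟩ := Nat.exists_eq_pow_mul_and_not_dvd hE q hq.out.ne_one
  have hmq : m.Coprime q := ((Nat.Prime.coprime_iff_not_dvd hq.out).2 hm).symm
  have hpow (w : G) (j : ℕ) (hw : orderOf w = q ^ j) : q ^ j ∣ q ^ e :=
    (hmq.symm.pow_left j).dvd_of_dvd_mul_right (hem ▸ hw ▸ Monoid.order_dvd_exponent w)
  have hqe : q ^ e ≠ 0 := pow_ne_zero _ hq.out.ne_zero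
  have hm0 : m ≠ 0 := by
    rintro rfl
    exact hm (dvd_zero q)
  have hb : orderOf (a ^ q ^ e) = m := by
    rw [orderOf_pow_of_dvd hqe (ha ▸ hem ▸ dvd_mul_right _ _), ha, hem,
      Nat.mul_div_cancel_left _ (Nat.pos_of_ne_zero hqe)]
  have hz : orderOf (a ^ m) = q ^ e := by
    rw [orderOf_pow_of_dvd hm0 (ha ▸ hem ▸ dvd_mul_left _ _), ha, hem,
      Nat.mul_div_cancel _ (Nat.pos_of_ne_zero hm0)]
  have hbz : Commute (a ^ q ^ e) (a ^ m) := (Commute.refl a).pow_pow _ _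
  set b := a ^ q ^ e
  set z := a ^ m
  have hzQ : z ∈ Q := mem_sylow_of_orderOf_eq_pow Q hz
  have hbQ : orderOf b ∣ (Q : Subgroup G).index := by
    refine (hb ▸ hmq.pow_right n).dvd_of_dvd_mul_left ?_
    rw [← hn, hcard]
    exact orderOf_dvd_natCard b
  have hmQ : (Q : Subgroup G).index ∣ m :=
    ((hx.coprime_dvd_left hindex).pow_right e).dvd_of_dvd_mul_left
      (hem ▸ hindex.trans (Monoid.order_dvd_exponent x))
  have hz1 : z ≠ 1 := by
    intro hz1
    have h1 := hpow y i hi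
    rw [← hz, hz1, orderOf_one, ← hi, Nat.dvd_one, orderOf_eq_one_iff] at h1
    exact hy1 h1
  have hbcomm {v : G} (hv : v ∈ Q) : Commute b v := by
    rcases (h.subgroup Q).isCyclic_or_of_isPGroup Q.2 with hc | ⟨⟨e'⟩⟩ | ⟨⟨e'⟩⟩
    · exact commute_of_isMulCommutative_of_normal hprop (Q : Subgroup G) Q.2 inferInstance hbQ
        (hb ▸ hmq) hzQ hz1 hbz hv
    · have hexp : Monoid.exponent Q = 4 := by
        rw [Monoid.exponent_eq_of_mulEquiv e', QuaternionGroup.exponent]; rfl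
      have hcQ : Nat.card Q = 2 ^ 3 := by
        rw [Nat.card_congr e'.toEquiv, Nat.card_eq_fintype_card, QuaternionGroup.card]; rfl
      have hq2 : q = 2 := by
        have h1 : 2 ∣ q ^ n := by rw [← hn, hcQ]; decide
        exact ((Nat.prime_dvd_prime_iff_eq Nat.prime_two hq.out).1
          (Nat.prime_two.dvd_of_dvd_pow h1)).symm
      refine commute_of_quaternionGroup_two_of_normal (Q : Subgroup G) e' (hq2 ▸ hb ▸ hmq) hzQ
        (Nat.dvd_antisymm ?_ ?_) hbz hv
      · rw [← hexp, ← orderOf_mk z hzQ]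
        exact Monoid.order_dvd_exponent _
      · rw [← hexp, hz]
        refine Monoid.exponent_dvd_of_forall_pow_eq_one fun w => ?_
        obtain ⟨j, hj⟩ := IsPGroup.iff_orderOf.1 Q.2 w
        exact orderOf_dvd_iff_pow_eq_one.1 (hj ▸ hpow w j (by rw [orderOf_coe, hj]))
    · have : IsMulCommutative Q := ⟨⟨fun s t => e'.injective (by rw [map_mul, map_mul, mul_comm])⟩⟩
      exact commute_of_isMulCommutative_of_normal hprop (Q : Subgroup G) Q.2 this hbQ
        (hb ▸ hmq) hzQ hz1 hbz hv
  have hbtop : (Q : Subgroup G) ⊔ zpowers b = ⊤ := by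
    refine eq_top_of_le_card _ (Nat.le_of_dvd Nat.card_pos ?_)
    have hco : (Nat.card Q).Coprime (Q : Subgroup G).index := by
      rw [hn]
      exact ((hmq.coprime_dvd_left hmQ).pow_right n).symm
    rw [← hcard]
    refine hco.mul_dvd_of_dvd_of_dvd (card_dvd_of_le le_sup_left) (hmQ.trans ?_)
    rw [← hb, ← Nat.card_zpowers]
    exact card_dvd_of_le le_sup_right
  obtain ⟨v, hv, w, ⟨k, rfl⟩, rfl⟩ := mem_sup_of_normal_left.1 (hbtop ▸ mem_top x)
  obtain ⟨j, hj⟩ := exists_pow_eq_self_of_coprime (hn ▸ hx.symm.pow_left n :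
    (Nat.card Q).Coprime (orderOf (v * b ^ k)))
  have hvn : v ^ Nat.card Q = 1 := congrArg Subtype.val (pow_card_eq_one' (x := (⟨v, hv⟩ : Q)))
  rw [← hj]
  simp only [((hbcomm hv).symm.zpow_right k).mul_pow, hvn, one_mul]
  exact (((hbcomm hy).zpow_left k).pow_left _).pow_left j

theorem PhiDivisible.isNilpotent_of_forall_ne_top (h : PhiDivisible G)
    (hprop : ∀ H : Subgroup G, H ≠ ⊤ → Group.IsNilpotent H) : Group.IsNilpotent G := by
  refine (Group.isNilpotent_of_finite_tfae.out 0 3).2 fun p hp P => ?_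
  have : Fact p.Prime := hp
  by_contra hP
  have hor {r : ℕ} [hr : Fact r.Prime] (R : Sylow r G) : IsMulCommutative R ∨ r = 2 := by
    rcases (h.subgroup R).isCyclic_or_of_isPGroup R.2 with hc | ⟨⟨e⟩⟩ | ⟨⟨e⟩⟩
    · exact .inl inferInstance
    · obtain ⟨n, hn⟩ := IsPGroup.iff_card.1 R.2
      rw [Nat.card_congr e.toEquiv, Nat.card_eq_fintype_card, QuaternionGroup.card] at hn
      refine .inr (((Nat.prime_dvd_prime_iff_eq Nat.prime_two hr.out).1
        (Nat.prime_two.dvd_of_dvd_pow (n := n) ?_)).symm)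
      rw [← hn]
      decide
    · exact .inl ⟨⟨fun s t => e.injective (by rw [map_mul, map_mul, mul_comm])⟩⟩
  have hnormal {q : ℕ} [hq : Fact q.Prime] (hqp : q ≠ p) (Q : Sylow q G) :
      (Q : Subgroup G).Normal := by
    rcases hor P with hPc | rfl
    · exact sylow_normal_of_sylow_not_normal hprop P hPc hP hqp Q
    · by_contra hQ
      exact hP (sylow_normal_of_sylow_not_normal hprop Q ((hor Q).resolve_right hqp) hQ hqp.symm P)
  refine hP (normalizer_eq_top_iff.1 (eq_top_of_forall_exists_sylow_le _ fun r hr => ?_))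
  by_cases hrp : r = p
  · subst hrp
    exact ⟨P, le_normalizer⟩
  · obtain ⟨R⟩ : Nonempty (Sylow r G) := inferInstance
    have := hnormal hrp R
    refine ⟨R, fun y hy => mem_normalizer_fintype fun x hx => ?_⟩
    obtain ⟨i, hi⟩ := IsPGroup.iff_orderOf.1 P.2 ⟨x, hx⟩
    rw [orderOf_mk] at hi
    have hc := h.commute_of_sylow_normal hprop R
      (hi ▸ Nat.Coprime.pow_left i ((Nat.coprime_primes hp.out hr.out).2 (Ne.symm hrp))) hy
    rwa [← hc.eq, mul_inv_cancel_right]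

end Nilpotent

theorem PhiDivisible.isNilpotent {G : Type*} [Group G] [Finite G] (h : PhiDivisible G) :
    Group.IsNilpotent G := by
  induction hn : Nat.card G using Nat.strong_induction_on generalizing G with
  | _ n ih =>
    refine h.isNilpotent_of_forall_ne_top fun H hH => ih _ ?_ (h.subgroup H) rfl
    rw [← hn]
    exact lt_of_le_of_ne (card_le_card_group H) fun heq => hH (eq_top_of_card_eq H heq)

theorem stmt_1 (G : Type*) [Group G] [Finite G]
    (hne : ∀ S : Subgroup G, phi S ≠ 0)
    (hdvd : ∀ H K : Subgroup G, H ≤ K → phi H ∣ phi K) :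
    Group.IsNilpotent G ∧
      ∀ (p : ℕ) (_ : Fact p.Prime) (P : Sylow p G),
        IsCyclic P ∨ Nonempty (P ≃* QuaternionGroup 2) ∨
          Nonempty (P ≃* (Multiplicative (ZMod p) × Multiplicative (ZMod p))) := by
  have h : PhiDivisible G := ⟨hne, hdvd⟩
  exact ⟨h.isNilpotent, fun p _ P => (h.subgroup P).isCyclic_or_of_isPGroup P.isPGroup'⟩
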